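/- For all integers 1 ≤ m ≤ n, the type B Jones–Wenzl projectors satisfy the absorption rules ι_{m,n}(b_{m,+})·b_{n,+} = b_{n,+} = b_{n,+}·ι_{m,n}(b_{m,+}) and ι_{m,n}(b_{m,−})·b_{n,−} = b_{n,−} = b_{n,−}·ι_{m,n}(b_{m,−}). -/

import Mathlib

noncomputable section

/-- The ground field `K = ℂ(q)`, the complex rational functions. -/
abbrev K : Type := RatFunc ℂ

/-- The variable `q ∈ K = ℂ(q)`. -/
noncomputable def q : K := RatFunc.X

/-- `δ = q + q⁻¹ ∈ K`. -/
noncomputable def δ : K := q + q⁻¹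

/-- Defining relations of the type `B` Temperley–Lieb algebra `TL(Bₙ)` (over `K`, with
`δ = q + q⁻¹`): the generator of index `0` is `s₀` and the generator of index `i`
(for `1 ≤ i ≤ n-1`) is `Uᵢ`.  The relations are `Uᵢ² = δUᵢ`, `UᵢU_{i+1}Uᵢ = Uᵢ`,
`U_{i+1}UᵢU_{i+1} = U_{i+1}`, `UᵢUⱼ = UⱼUᵢ` for `|i-j| ≥ 2`, `s₀² = 1`, `U₁s₀U₁ = 0` and
`s₀Uᵢ = Uᵢs₀` for `i ≥ 2`. -/
inductive TLBRel (n : ℕ) : FreeAlgebra K (Fin n) → FreeAlgebra K (Fin n) → Prop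
  | Usq (i : Fin n) (hi : 1 ≤ (i : ℕ)) :
      TLBRel n (FreeAlgebra.ι K i * FreeAlgebra.ι K i) (δ • FreeAlgebra.ι K i)
  | braid₁ (i j : Fin n) (hi : 1 ≤ (i : ℕ)) (hj : (j : ℕ) = (i : ℕ) + 1) :
      TLBRel n (FreeAlgebra.ι K i * FreeAlgebra.ι K j * FreeAlgebra.ι K i) (FreeAlgebra.ι K i)
  | braid₂ (i j : Fin n) (hi : 1 ≤ (i : ℕ)) (hj : (j : ℕ) = (i : ℕ) + 1) :
      TLBRel n (FreeAlgebra.ι K j * FreeAlgebra.ι K i * FreeAlgebra.ι K j) (FreeAlgebra.ι K j)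
  | Ucomm (i j : Fin n) (hi : 1 ≤ (i : ℕ)) (h : (i : ℕ) + 2 ≤ (j : ℕ)) :
      TLBRel n (FreeAlgebra.ι K i * FreeAlgebra.ι K j) (FreeAlgebra.ι K j * FreeAlgebra.ι K i)
  | s0sq (i : Fin n) (hi : (i : ℕ) = 0) : TLBRel n (FreeAlgebra.ι K i * FreeAlgebra.ι K i) 1
  | UsU (i j : Fin n) (hi : (i : ℕ) = 0) (hj : (j : ℕ) = 1) :
      TLBRel n (FreeAlgebra.ι K j * FreeAlgebra.ι K i * FreeAlgebra.ι K j) 0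
  | s0comm (i j : Fin n) (hi : (i : ℕ) = 0) (h : 2 ≤ (j : ℕ)) :
      TLBRel n (FreeAlgebra.ι K i * FreeAlgebra.ι K j) (FreeAlgebra.ι K j * FreeAlgebra.ι K i)

/-- The type `B` Temperley–Lieb algebra `TL(Bₙ)` over `K = ℂ(q)` with `δ = q + q⁻¹`. -/
abbrev TLB (n : ℕ) := RingQuot (TLBRel n)

/-- The generator of `TL(Bₙ)` with index `i`: `g n 0 = s₀`, and `g n i = Uᵢ` for
`1 ≤ i ≤ n-1` (indices out of range are sent to `0`). -/
noncomputable def g (n : ℕ) (i : ℕ) : TLB n :=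
  if h : i < n then RingQuot.mkAlgHom K (TLBRel n) (FreeAlgebra.ι K ⟨i, h⟩) else 0

/-- `IsJW n ε b` says that `b` is a type `B` Jones–Wenzl projector of sign `ε` in `TL(Bₙ)`:
`b` is a nonzero idempotent with `s₀·b = ε·b = b·s₀` and `Uᵢ·b = 0 = b·Uᵢ` for all
`1 ≤ i ≤ n-1`.  For `ε = 1` this characterizes `b_{n,+}` and for `ε = -1` it characterizes
`b_{n,-}`. -/
def IsJW (n : ℕ) (ε : K) (b : TLB n) : Prop :=
  b ≠ 0 ∧ b * b = b ∧ g n 0 * b = ε • b ∧ b * g n 0 = ε • b ∧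
    ∀ i : ℕ, 1 ≤ i → i ≤ n - 1 → g n i * b = 0 ∧ b * g n i = 0

theorem g_of_lt {n i : ℕ} (h : i < n) :
    g n i = RingQuot.mkAlgHom K (TLBRel n) (FreeAlgebra.ι K ⟨i, h⟩) :=
  dif_pos h

/-- The canonical homomorphism `TL(B_m) → TL(Bₙ)` for `m ≤ n`. -/
def TLB.inclusion {m n : ℕ} (hmn : m ≤ n) : TLB m →ₐ[K] TLB n :=
  RingQuot.liftAlgHom K ⟨FreeAlgebra.lift K fun i =>
      RingQuot.mkAlgHom K (TLBRel n) (FreeAlgebra.ι K (Fin.castLE hmn i)), by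
    intro x y h
    have key : ∀ {a b}, TLBRel n a b →
        RingQuot.mkAlgHom K (TLBRel n) a = RingQuot.mkAlgHom K (TLBRel n) b :=
      fun h => RingQuot.mkAlgHom_rel K h
    cases h with
    | Usq i hi => simpa using key (.Usq (Fin.castLE hmn i) hi)
    | braid₁ i j hi hj => simpa using key (.braid₁ (Fin.castLE hmn i) (Fin.castLE hmn j) hi hj)
    | braid₂ i j hi hj => simpa using key (.braid₂ (Fin.castLE hmn i) (Fin.castLE hmn j) hi hj)
    | Ucomm i j hi h => simpa using key (.Ucomm (Fin.castLE hmn i) (Fin.castLE hmn j) hi h)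
    | s0sq i hi => simpa using key (.s0sq (Fin.castLE hmn i) hi)
    | UsU i j hi hj => simpa using key (.UsU (Fin.castLE hmn i) (Fin.castLE hmn j) hi hj)
    | s0comm i j hi h => simpa using key (.s0comm (Fin.castLE hmn i) (Fin.castLE hmn j) hi h)⟩

theorem TLB.inclusion_g {m n : ℕ} (hmn : m ≤ n) {i : ℕ} (hi : i < m) :
    TLB.inclusion hmn (g m i) = g n i := by
  rw [g_of_lt hi, g_of_lt (hi.trans_le hmn)]
  simp [TLB.inclusion]

/-- The character of `TL(Bₙ)` with `s₀ ↦ ε` and `Uᵢ ↦ 0`, for a sign `ε`. -/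
def TLB.character (n : ℕ) {ε : K} (hε : ε * ε = 1) : TLB n →ₐ[K] K :=
  RingQuot.liftAlgHom K ⟨FreeAlgebra.lift K fun i : Fin n => if (i : ℕ) = 0 then ε else 0, by
    intro x y h
    cases h with
    | Usq i hi => simp [Nat.one_le_iff_ne_zero.mp hi]
    | braid₁ i j hi hj => simp [Nat.one_le_iff_ne_zero.mp hi]
    | braid₂ i j hi hj => simp [hj]
    | Ucomm i j hi h => simp [Nat.one_le_iff_ne_zero.mp hi]
    | s0sq i hi => simp [hi, hε]
    | UsU i j hi hj => simp [hj]
    | s0comm i j hi h => simp [mul_comm]⟩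

theorem TLB.character_g {n : ℕ} {ε : K} (hε : ε * ε = 1) {i : ℕ} (hi : i < n) :
    TLB.character n hε (g n i) = if i = 0 then ε else 0 := by
  rw [g_of_lt hi]
  simp [TLB.character]

/-- Induction on elements of `TL(Bₙ)`, seen as polynomials in the generators. -/
theorem TLB.induction {n : ℕ} {P : TLB n → Prop} (scalar : ∀ r : K, P (algebraMap K _ r))
    (gen : ∀ i < n, P (g n i)) (mul : ∀ x y, P x → P y → P (x * y))
    (sum : ∀ x y, P x → P y → P (x + y)) (x : TLB n) : P x := by
  obtain ⟨x, rfl⟩ := RingQuot.mkAlgHom_surjective K (TLBRel n) x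
  induction x using FreeAlgebra.induction with
  | grade0 r => simpa using scalar r
  | grade1 i => simpa [g_of_lt i.2] using gen i i.2
  | mul x y hx hy => simpa using mul _ _ hx hy
  | add x y hx hy => simpa using sum _ _ hx hy

section Absorption

variable {m n : ℕ} {ε : K} {φ : TLB m →ₐ[K] TLB n} {b : TLB n}

theorem IsJW.algHom_mul_eq_smul (hε : ε * ε = 1) (hmn : m ≤ n) (hφ : ∀ i < m, φ (g m i) = g n i)
    (hb : IsJW n ε b) (x : TLB m) : φ x * b = TLB.character m hε x • b := by
  obtain ⟨-, -, hs, -, hU⟩ := hb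
  induction x using TLB.induction with
  | scalar r => simp [Algebra.smul_def]
  | gen i hi =>
    rw [hφ i hi, TLB.character_g hε hi]
    split_ifs with h
    · rw [h, hs]
    · rw [(hU i (by omega) (by omega)).1, zero_smul]
  | mul x y hx hy => rw [map_mul, mul_assoc, hy, mul_smul_comm, hx, map_mul, smul_smul, mul_comm]
  | sum x y hx hy => rw [map_add, add_mul, hx, hy, map_add, add_smul]

theorem IsJW.mul_algHom_eq_smul (hε : ε * ε = 1) (hmn : m ≤ n) (hφ : ∀ i < m, φ (g m i) = g n i)
    (hb : IsJW n ε b) (x : TLB m) : b * φ x = TLB.character m hε x • b := by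
  obtain ⟨-, -, -, hs, hU⟩ := hb
  induction x using TLB.induction with
  | scalar r => rw [AlgHom.commutes, AlgHom.commutes, ← Algebra.commutes, Algebra.smul_def]; rfl
  | gen i hi =>
    rw [hφ i hi, TLB.character_g hε hi]
    split_ifs with h
    · rw [h, hs]
    · rw [(hU i (by omega) (by omega)).2, zero_smul]
  | mul x y hx hy => rw [map_mul, ← mul_assoc, hx, smul_mul_assoc, hy, map_mul, smul_smul]
  | sum x y hx hy => rw [map_add, mul_add, hx, hy, map_add, add_smul]

theorem IsJW.character_eq_one (hε : ε * ε = 1) (hb : IsJW n ε b) :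
    TLB.character n hε b = 1 := by
  have h := hb.algHom_mul_eq_smul hε le_rfl (φ := AlgHom.id K _) (fun _ _ => rfl) b
  rw [AlgHom.id_apply, hb.2.1] at h
  exact smul_left_injective K hb.1 (by simpa using h.symm)

theorem IsJW.absorb (hε : ε * ε = 1) (hmn : m ≤ n) (hφ : ∀ i < m, φ (g m i) = g n i)
    {a : TLB m} (ha : IsJW m ε a) (hb : IsJW n ε b) : φ a * b = b ∧ b * φ a = b := by
  rw [hb.algHom_mul_eq_smul hε hmn hφ, hb.mul_algHom_eq_smul hε hmn hφ, 
    ha.character_eq_one hε, one_smul]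
  exact ⟨rfl, rfl⟩

end Absorption

/-- (Box absorption.)  Let `1 ≤ m ≤ n`.  The canonical inclusion
`ι_{m,n} : TL(B_m) → TL(Bₙ)` (the `K`-algebra homomorphism with `ι(s₀) = s₀` and
`ι(Uᵢ) = Uᵢ` for `1 ≤ i ≤ m-1`, i.e. sending each generator to the generator of the same
index) exists, and for any such `ι` the type `B` Jones–Wenzl projectors satisfy the
absorption rules `ι(b_{m,+})·b_{n,+} = b_{n,+} = b_{n,+}·ι(b_{m,+})` and
`ι(b_{m,-})·b_{n,-} = b_{n,-} = b_{n,-}·ι(b_{m,-})`. -/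
theorem stmt_13 (m n : ℕ) (hm : 1 ≤ m) (hmn : m ≤ n) :
    (∃ ι : TLB m →ₐ[K] TLB n, ∀ i : ℕ, i < m → ι (g m i) = g n i) ∧
    (∀ ι : TLB m →ₐ[K] TLB n, (∀ i : ℕ, i < m → ι (g m i) = g n i) →
      ∀ bmp bnp bmm bnm : _,
        IsJW m 1 bmp → IsJW n 1 bnp → IsJW m (-1) bmm → IsJW n (-1) bnm →
          (ι bmp * bnp = bnp ∧ bnp * ι bmp = bnp) ∧
          (ι bmm * bnm = bnm ∧ bnm * ι bmm = bnm)) := by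
  exact ⟨⟨TLB.inclusion hmn, fun i hi => TLB.inclusion_g hmn hi⟩,
    fun ι hι bmp bnp bmm bnm hmp hnp hmm hnm =>
      ⟨hmp.absorb (by simp) hmn hι hnp, hmm.absorb (by simp) hmn hι hnm⟩⟩
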